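/- arXiv:2206.11543 — 3 statements merged into one kernel-verified Lean document; each statement's English description precedes it below -/
import Mathlib

section
/- For every δ > 0 there exist a sequence (v_k) of smooth solutions of the cubic Szegő equation on the circle and a sequence (t_k) of positive times such that, as k → ∞: t_k → 0; the W^{−δ,2} Sobolev norm of v_k(0, ·) tends to 0, i.e. ∑_{n≥0} (1+n²)^{−δ} |v̂_k(0, n)|² → 0; and |v̂_k(t_k, 0)| → +∞ (so the mean value ⟨v_k(t_k), 1⟩ blows up). Here each v_k : ℝ × 𝕋 → ℂ is smooth, all negative Fourier coefficients of v_k(t, ·) vanish for every t, and v_k solves the cubic Szegő equation in the sense that for every n ≥ 0 the Fourier coefficient t ↦ v̂_k(t, n) is differentiable with i·(d/dt) v̂_k(t, n) = (|v_k(t,·)|² v_k(t,·))^(n), the n-th Fourier coefficient of |v_k|² v_k. -/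
open Filter

noncomputable section

/-- The `n`-th Fourier coefficient of a `2π`-periodic function `g : ℝ → ℂ`. -/
def fc (g : ℝ → ℂ) (n : ℤ) : ℂ :=
  (1 / (2 * Real.pi)) * ∫ x in (0 : ℝ)..(2 * Real.pi),
    g x * Complex.exp (-Complex.I * (n : ℂ) * (x : ℂ))

lemma fc_const_mul (a : ℂ) (g : ℝ → ℂ) (n : ℤ) : fc (fun x => a * g x) n = a * fc g n := by
  simp only [fc, mul_assoc, intervalIntegral.integral_const_mul]
  ring

lemma fc_add {f g : ℝ → ℂ} (hf : Continuous f) (hg : Continuous g) (n : ℤ) :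
    fc (fun x => f x + g x) n = fc f n + fc g n := by
  simp only [fc, add_mul]
  rw [intervalIntegral.integral_add
    (Continuous.intervalIntegrable (by fun_prop) _ _)
    (Continuous.intervalIntegrable (by fun_prop) _ _)]
  ring

lemma fc_exp (m n : ℤ) :
    fc (fun x => Complex.exp (Complex.I * m * x)) n = if n = m then 1 else 0 := by
  have hpi : (Real.pi : ℂ) ≠ 0 := by exact_mod_cast Real.pi_ne_zero
  have h (x : ℝ) : Complex.exp (Complex.I * m * x) * Complex.exp (-Complex.I * n * x)
      = Complex.exp ((Complex.I * (m - n)) * x) := by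
    rw [← Complex.exp_add]; congr 1; ring
  simp only [fc, h]
  split_ifs with hnm
  · subst hnm
    simp
    field_simp
  · have hne : Complex.I * ((m : ℂ) - n) ≠ 0 := by
      refine mul_ne_zero Complex.I_ne_zero (sub_ne_zero.mpr ?_)
      exact_mod_cast Ne.symm hnm
    rw [integral_exp_mul_complex hne]
    have : Complex.I * ((m : ℂ) - n) * ((2 * Real.pi : ℝ) : ℂ)
        = ((m - n : ℤ) : ℂ) * (2 * Real.pi * Complex.I) := by push_cast; ring
    rw [this, Complex.exp_int_mul_two_pi_mul_I]
    simp

/-- Fourier coefficients of an absolutely convergent trigonometric series. -/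
lemma hasSum_fc {g : ℝ → ℂ} {a : ℕ → ℂ} {e : ℕ → ℤ} (ha : Summable fun j => ‖a j‖)
    (hg : ∀ x : ℝ, HasSum (fun j => a j * Complex.exp (Complex.I * e j * x)) (g x)) (n : ℤ) :
    HasSum (fun j => if n = e j then a j else 0) (fc g n) := by
  have hnorm (m : ℤ) (x : ℝ) : ‖Complex.exp (Complex.I * m * x)‖ = 1 := by
    have : Complex.I * m * x = ((m * x : ℝ) : ℂ) * Complex.I := by push_cast; ring
    rw [this, Complex.norm_exp_ofReal_mul_I]
  have hnorm' (m : ℤ) (x : ℝ) : ‖Complex.exp (-Complex.I * m * x)‖ = 1 := by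
    have : -Complex.I * m * x = Complex.I * (-m : ℤ) * x := by push_cast; ring
    rw [this, hnorm]
  have key : HasSum (fun j => ∫ x in (0 : ℝ)..(2 * Real.pi),
      a j * Complex.exp (Complex.I * e j * x) * Complex.exp (-Complex.I * (n : ℂ) * (x : ℂ)))
      (∫ x in (0 : ℝ)..(2 * Real.pi), g x * Complex.exp (-Complex.I * (n : ℂ) * (x : ℂ))) := by
    refine intervalIntegral.hasSum_integral_of_dominated_convergence (fun j _ => ‖a j‖) ?_ ?_ ?_ ?_ ?_
    · intro j
      exact Continuous.aestronglyMeasurable (by fun_prop)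
    · intro j
      refine Eventually.of_forall fun x _ => ?_
      rw [norm_mul, norm_mul, hnorm, hnorm', mul_one, mul_one]
    · exact Eventually.of_forall fun x _ => ha
    · exact intervalIntegrable_const
    · exact Eventually.of_forall fun x _ => (hg x).mul_right _
  have h2 := key.mul_left (1 / (2 * Real.pi) : ℂ)
  refine HasSum.congr_fun h2 fun j => ?_
  have h3 := fc_const_mul (a j) (fun x => Complex.exp (Complex.I * e j * x)) n
  rw [fc_exp] at h3
  simp only [fc] at h3
  rw [h3]
  split_ifs <;> simp

/-- Differentiation of Fourier coefficients with respect to a parameter. -/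
lemma hasDerivAt_fc {F F' : ℝ → ℝ → ℂ} (hF : Continuous fun q : ℝ × ℝ => F q.1 q.2)
    (hF' : Continuous fun q : ℝ × ℝ => F' q.1 q.2)
    (h : ∀ t x, HasDerivAt (fun s => F s x) (F' t x) t) (n : ℤ) (t : ℝ) :
    HasDerivAt (fun s => fc (F s) n) (fc (F' t) n) t := by
  have hFs (s : ℝ) : Continuous (F s) := hF.comp (Continuous.prodMk_right s)
  have hFs' (s : ℝ) : Continuous (F' s) := hF'.comp (Continuous.prodMk_right s)
  have hG' : Continuous fun q : ℝ × ℝ =>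
      F' q.1 q.2 * Complex.exp (-Complex.I * (n : ℂ) * (q.2 : ℂ)) := by fun_prop
  obtain ⟨C, hC⟩ := ((isCompact_Icc (a := t - 1) (b := t + 1)).prod
    (isCompact_Icc (a := (0 : ℝ)) (b := 2 * Real.pi))).exists_bound_of_continuousOn
    hG'.continuousOn
  refine HasDerivAt.const_mul _ (intervalIntegral.hasDerivAt_integral_of_dominated_loc_of_deriv_le
    (F' := fun s x => F' s x * Complex.exp (-Complex.I * (n : ℂ) * (x : ℂ)))
    (s := Set.Icc (t - 1) (t + 1)) (bound := fun _ => C)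
    (Icc_mem_nhds (by linarith) (by linarith)) ?_ ?_ ?_ ?_ ?_ ?_).2
  · exact Eventually.of_forall fun s =>
      Continuous.aestronglyMeasurable (by have := hFs s; fun_prop)
  · exact Continuous.intervalIntegrable (by have := hFs t; fun_prop) _ _
  · exact Continuous.aestronglyMeasurable (by have := hFs' t; fun_prop)
  · refine Eventually.of_forall fun x hx s hs => hC (s, x) ⟨hs, ?_⟩
    rw [Set.uIoc_of_le (by positivity)] at hx
    exact Set.Ioc_subset_Icc_self hx
  · exact intervalIntegrable_const
  · exact Eventually.of_forall fun x _ s _ => (h s x).mul_const _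

/-- The unimodular oscillation `exp (-i r t)`. -/
def osc (r t : ℝ) : ℂ := Complex.exp (-Complex.I * r * t)

lemma osc_ne_zero (r t : ℝ) : osc r t ≠ 0 := Complex.exp_ne_zero _

lemma contDiff_osc (r : ℝ) : ContDiff ℝ (⊤ : ℕ∞) (osc r) := by
  unfold osc
  exact ContDiff.cexp (contDiff_const.mul Complex.ofRealCLM.contDiff)

lemma conj_osc (r t : ℝ) : (starRingEnd ℂ) (osc r t) = (osc r t)⁻¹ := by
  simp only [osc, ← Complex.exp_conj, ← Complex.exp_neg]
  congr 1
  simp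

lemma norm_osc (r t : ℝ) : ‖osc r t‖ = 1 := by
  have : -Complex.I * r * t = ((-(r * t) : ℝ) : ℂ) * Complex.I := by push_cast; ring
  rw [osc, this, Complex.norm_exp_ofReal_mul_I]

lemma hasDerivAt_osc (r t : ℝ) : HasDerivAt (osc r) (-Complex.I * r * osc r t) t := by
  have h : HasDerivAt (fun s : ℝ => -Complex.I * r * (s : ℂ)) (-Complex.I * r) t := by
    simpa using (Complex.ofRealCLM.hasDerivAt (x := t)).const_mul (-Complex.I * r)
  unfold osc
  convert h.cexp using 1
  ring

/-- The mean value of the explicit rational solution. -/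
def szB (t : ℝ) : ℂ := 40 / 13 * (osc 64 t - osc 25 t)

/-- The first Fourier coefficient of the explicit rational solution. -/
def szC (t : ℝ) : ℂ := 40 / 1183 * (8 * osc 64 t + 5 * osc 25 t) ^ 2 * osc (-49) t

/-- The inverse pole of the explicit rational solution. -/
def szP (t : ℝ) : ℂ := (64 / 91 * osc 64 t - 25 / 91 * osc 25 t) * osc (-49) t

lemma norm_szP_lt (t : ℝ) : ‖szP t‖ < 1 := by
  rw [szP, norm_mul, norm_osc, mul_one]
  refine (norm_sub_le _ _).trans_lt ?_
  rw [norm_mul, norm_mul, norm_osc, norm_osc]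
  norm_num

/-- The inverse of `1 - |p|²`. -/
def szM (t : ℝ) : ℂ := (1 - szP t * (starRingEnd ℂ) (szP t))⁻¹

lemma one_sub_szP_mul_conj_ne_zero (t : ℝ) : 1 - szP t * (starRingEnd ℂ) (szP t) ≠ 0 := by
  rw [Complex.mul_conj, Complex.normSq_eq_norm_sq]
  have h := norm_szP_lt t
  have h' : 1 - ‖szP t‖ ^ 2 ≠ 0 := by nlinarith [norm_nonneg (szP t)]
  exact_mod_cast h'

lemma szC_mul_conj_mul_szM (t : ℝ) :
    szC t * (starRingEnd ℂ) (szC t) * szM t = 49 * (1 - szP t * (starRingEnd ℂ) (szP t)) := by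
  rw [szM, mul_inv_eq_iff_eq_mul₀ (one_sub_szP_mul_conj_ne_zero t)]
  simp only [szC, szP, map_mul, map_add, map_sub, map_pow, map_div₀, map_ofNat, conj_osc]
  have h1 := osc_ne_zero 64 t
  have h2 := osc_ne_zero 25 t
  have h3 := osc_ne_zero (-49) t
  field_simp
  ring

lemma hasDerivAt_szB (t : ℝ) : HasDerivAt szB
    (-Complex.I * (szB t ^ 2 * (starRingEnd ℂ) (szB t) +
      szC t * (starRingEnd ℂ) (szC t) * szM t *
        (2 * szB t + szC t * (starRingEnd ℂ) (szP t) * szM t))) t := by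
  have h : HasDerivAt szB (40 / 13 * (-Complex.I * (64 : ℝ) * osc 64 t
      - -Complex.I * (25 : ℝ) * osc 25 t)) t :=
    ((hasDerivAt_osc 64 t).sub (hasDerivAt_osc 25 t)).const_mul _
  convert h using 1
  have hm : (1 - szP t * (starRingEnd ℂ) (szP t)) * szM t = 1 :=
    mul_inv_cancel₀ (one_sub_szP_mul_conj_ne_zero t)
  have e : szB t ^ 2 * (starRingEnd ℂ) (szB t) +
      szC t * (starRingEnd ℂ) (szC t) * szM t *
        (2 * szB t + szC t * (starRingEnd ℂ) (szP t) * szM t) =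
      szB t ^ 2 * (starRingEnd ℂ) (szB t) + 98 * (1 - szP t * (starRingEnd ℂ) (szP t)) * szB t
        + 49 * szC t * (starRingEnd ℂ) (szP t) := by
    rw [szC_mul_conj_mul_szM]
    linear_combination 49 * szC t * (starRingEnd ℂ) (szP t) * hm
  rw [e]
  simp only [szB, szC, szP, map_mul, map_sub, map_div₀, map_ofNat, conj_osc]
  have h1 := osc_ne_zero 64 t
  have h2 := osc_ne_zero 25 t
  have h3 := osc_ne_zero (-49) t
  push_cast
  field_simp
  ring

lemma hasDerivAt_szC (t : ℝ) : HasDerivAt szC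
    (-Complex.I * (2 * szB t * (starRingEnd ℂ) (szB t) * szC t +
      szC t * (starRingEnd ℂ) (szC t) * szM t *
        (2 * szP t * szB t + szC t * szM t))) t := by
  have h : HasDerivAt szC _ t :=
    ((((hasDerivAt_osc 64 t).const_mul 8).add ((hasDerivAt_osc 25 t).const_mul 5)).pow 2
      |>.const_mul (40 / 1183 : ℂ)).mul (hasDerivAt_osc (-49) t)
  refine h.congr_deriv ?_
  have hm : (1 - szP t * (starRingEnd ℂ) (szP t)) * szM t = 1 :=
    mul_inv_cancel₀ (one_sub_szP_mul_conj_ne_zero t)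
  have e : 2 * szB t * (starRingEnd ℂ) (szB t) * szC t +
      szC t * (starRingEnd ℂ) (szC t) * szM t * (2 * szP t * szB t + szC t * szM t) =
      2 * szB t * (starRingEnd ℂ) (szB t) * szC t
        + 98 * (1 - szP t * (starRingEnd ℂ) (szP t)) * szP t * szB t + 49 * szC t := by
    rw [szC_mul_conj_mul_szM]
    linear_combination 49 * szC t * hm
  rw [e]
  simp only [szB, szC, szP, map_mul, map_sub, map_div₀, map_ofNat, conj_osc,
    Pi.add_apply, Pi.pow_apply]
  have h1 := osc_ne_zero 64 t
  have h2 := osc_ne_zero 25 t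
  have h3 := osc_ne_zero (-49) t
  push_cast
  field_simp
  ring

lemma hasDerivAt_szP (t : ℝ) : HasDerivAt szP
    (-Complex.I * ((starRingEnd ℂ) (szB t) * szC t +
      szC t * (starRingEnd ℂ) (szC t) * szM t * szP t)) t := by
  have h : HasDerivAt szP _ t :=
    (((hasDerivAt_osc 64 t).const_mul (64 / 91 : ℂ)).sub
    ((hasDerivAt_osc 25 t).const_mul (25 / 91 : ℂ))).mul (hasDerivAt_osc (-49) t)
  refine h.congr_deriv ?_
  rw [szC_mul_conj_mul_szM]
  simp only [szB, szC, szP, map_mul, map_sub, map_div₀, map_ofNat, conj_osc,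
    Pi.sub_apply]
  have h1 := osc_ne_zero 64 t
  have h2 := osc_ne_zero 25 t
  have h3 := osc_ne_zero (-49) t
  push_cast
  field_simp
  ring

lemma contDiff_szB : ContDiff ℝ (⊤ : ℕ∞) szB := by
  have h1 := contDiff_osc 64
  have h2 := contDiff_osc 25
  unfold szB
  fun_prop

lemma contDiff_szC : ContDiff ℝ (⊤ : ℕ∞) szC := by
  have h1 := contDiff_osc 64
  have h2 := contDiff_osc 25
  have h3 := contDiff_osc (-49)
  unfold szC
  fun_prop

lemma contDiff_szP : ContDiff ℝ (⊤ : ℕ∞) szP := by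
  have h1 := contDiff_osc 64
  have h2 := contDiff_osc 25
  have h3 := contDiff_osc (-49)
  unfold szP
  fun_prop

/-- The rational function `z / (1 - p(t) z)`. -/
def szE (t : ℝ) (z : ℂ) : ℂ := z / (1 - szP t * z)

/-- The explicit rational solution, as a function of `z` on the unit circle. -/
def szU (t : ℝ) (z : ℂ) : ℂ := szB t + szC t * szE t z

/-- The antiholomorphic part of `|u|² u` for the explicit solution `u`. -/
def szR (t : ℝ) (z : ℂ) : ℂ :=
  (starRingEnd ℂ) (szC t) * (szB t + szC t * (starRingEnd ℂ) (szP t) * szM t) ^ 2 *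
    (starRingEnd ℂ) (szE t z)

lemma norm_szP_mul_lt (t : ℝ) {z : ℂ} (hz : ‖z‖ = 1) : ‖szP t * z‖ < 1 := by
  rw [norm_mul, hz, mul_one]
  exact norm_szP_lt t

lemma one_sub_szP_mul_ne_zero (t : ℝ) {z : ℂ} (hz : ‖z‖ = 1) : 1 - szP t * z ≠ 0 := by
  intro h
  have h2 := norm_szP_mul_lt t hz
  rw [← sub_eq_zero.mp h, norm_one] at h2
  exact lt_irrefl _ h2

lemma hasSum_szE (t : ℝ) {z : ℂ} (hz : ‖z‖ = 1) :
    HasSum (fun j : ℕ => szP t ^ j * z ^ (j + 1)) (szE t z) := by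
  have h := (hasSum_geometric_of_norm_lt_one (norm_szP_mul_lt t hz)).mul_left z
  rw [← div_eq_mul_inv] at h
  refine HasSum.congr_fun h fun j => ?_
  ring

lemma conj_szE_mul_sub (t : ℝ) {z : ℂ} (hz : ‖z‖ = 1) :
    (starRingEnd ℂ) (szE t z) * (szE t z - (starRingEnd ℂ) (szP t) * szM t)
      = szM t * (1 + szP t * szE t z) := by
  have hz0 : z ≠ 0 := by
    rintro rfl
    simp at hz
  have hcz : (starRingEnd ℂ) z = z⁻¹ := by
    rw [Complex.inv_def, Complex.normSq_eq_norm_sq, hz]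
    simp
  have h1 := one_sub_szP_mul_ne_zero t hz
  have h2 : 1 - (starRingEnd ℂ) (szP t) * z⁻¹ ≠ 0 := by
    rw [← hcz, ← map_mul, ← map_one (starRingEnd ℂ), ← map_sub]
    exact (map_ne_zero _).mpr h1
  have h3 := one_sub_szP_mul_conj_ne_zero t
  have h4 : z - (starRingEnd ℂ) (szP t) ≠ 0 := by
    intro h
    apply h2
    rw [← sub_eq_zero.mp h, mul_inv_cancel₀ hz0, sub_self]
  simp only [szE, szM, map_div₀, map_sub, map_one, map_mul, hcz]
  have h5 : z⁻¹ / (1 - (starRingEnd ℂ) (szP t) * z⁻¹) = (z - (starRingEnd ℂ) (szP t))⁻¹ := by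
    field_simp
  have h6 : z / (1 - szP t * z) - (starRingEnd ℂ) (szP t) *
      (1 - szP t * (starRingEnd ℂ) (szP t))⁻¹ = (z - (starRingEnd ℂ) (szP t)) *
      ((1 - szP t * (starRingEnd ℂ) (szP t))⁻¹ * (1 - szP t * z)⁻¹) := by
    rw [← div_eq_mul_inv, div_sub_div _ _ h1 h3, ← mul_inv, ← div_eq_mul_inv, mul_comm (1 - _)]
    ring
  have h7 : 1 + szP t * (z / (1 - szP t * z)) = (1 - szP t * z)⁻¹ := by
    refine eq_inv_of_mul_eq_one_left ?_
    rw [add_mul, mul_assoc, div_mul_cancel₀ _ h1]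
    ring
  rw [h5, h6, h7, inv_mul_cancel_left₀ h4]

lemma hasDerivAt_szU (t : ℝ) {z : ℂ} (hz : ‖z‖ = 1) : HasDerivAt (fun s => szU s z)
    (-Complex.I * ((Complex.normSq (szU t z) : ℂ) * szU t z - szR t z)) t := by
  have hE : HasDerivAt (fun s => szE s z) _ t :=
    (hasDerivAt_const t z).div (((hasDerivAt_szP t).mul_const z).const_sub 1)
      (one_sub_szP_mul_ne_zero t hz)
  have h : HasDerivAt (fun s => szU s z) _ t :=
    (hasDerivAt_szB t).add ((hasDerivAt_szC t).mul hE)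
  refine h.congr_deriv ?_
  set p' := -Complex.I * ((starRingEnd ℂ) (szB t) * szC t +
      szC t * (starRingEnd ℂ) (szC t) * szM t * szP t) with hp'
  have e : (0 * (1 - szP t * z) - z * -(p' * z)) / (1 - szP t * z) ^ 2 = p' * szE t z ^ 2 := by
    rw [szE, div_pow]
    ring
  rw [e, ← Complex.mul_conj, hp']
  have key := conj_szE_mul_sub t hz
  have hm : (1 - szP t * (starRingEnd ℂ) (szP t)) * szM t = 1 :=
    mul_inv_cancel₀ (one_sub_szP_mul_conj_ne_zero t)
  simp only [szU, szR, map_add, map_mul]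
  linear_combination (-Complex.I) * (-(starRingEnd ℂ) (szC t) * szC t *
    (2 * szB t + szC t * szE t z + szC t * (starRingEnd ℂ) (szP t) * szM t)) * key -
    Complex.I * szC t ^ 2 * (starRingEnd ℂ) (szC t) * szM t * szE t z * hm

/-- The point `exp (i N x)` of the unit circle. -/
def circ (N : ℕ) (x : ℝ) : ℂ := Complex.exp (Complex.I * N * x)

lemma norm_circ (N : ℕ) (x : ℝ) : ‖circ N x‖ = 1 := by
  have : Complex.I * N * x = ((N * x : ℝ) : ℂ) * Complex.I := by push_cast; ring
  rw [circ, this, Complex.norm_exp_ofReal_mul_I]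

lemma circ_pow (N j : ℕ) (x : ℝ) :
    circ N x ^ j = Complex.exp (Complex.I * ((N * j : ℕ) : ℤ) * x) := by
  rw [circ, ← Complex.exp_nat_mul]
  congr 1
  push_cast
  ring

lemma conj_circ_pow (N j : ℕ) (x : ℝ) :
    (starRingEnd ℂ) (circ N x) ^ j = Complex.exp (Complex.I * (-((N * j : ℕ) : ℤ) : ℤ) * x) := by
  rw [← map_pow, circ_pow, ← Complex.exp_conj]
  congr 1
  simp

lemma contDiff_circ (N : ℕ) : ContDiff ℝ (⊤ : ℕ∞) (circ N) := by
  unfold circ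
  exact ContDiff.cexp (contDiff_const.mul Complex.ofRealCLM.contDiff)

lemma contDiff_szE (N : ℕ) :
    ContDiff ℝ (⊤ : ℕ∞) (fun q : ℝ × ℝ => szE q.1 (circ N q.2)) := by
  have h1 := contDiff_szP
  have h2 := contDiff_circ N
  simp only [szE, div_eq_mul_inv]
  exact ContDiff.mul (by fun_prop) (ContDiff.inv (by fun_prop)
    fun q => one_sub_szP_mul_ne_zero _ (norm_circ _ _))

lemma continuous_szR (N : ℕ) : Continuous (fun q : ℝ × ℝ => szR q.1 (circ N q.2)) := by
  have h1 := contDiff_szB.continuous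
  have h2 := contDiff_szC.continuous
  have h3 := contDiff_szP.continuous
  have h4 := (contDiff_szE N).continuous
  have h5 : Continuous szM := by
    unfold szM
    exact Continuous.inv₀ (by fun_prop) one_sub_szP_mul_conj_ne_zero
  unfold szR
  fun_prop

lemma summable_norm_szP_pow (t : ℝ) : Summable fun j : ℕ => ‖szP t ^ j‖ := by
  simp only [norm_pow]
  exact summable_geometric_of_lt_one (norm_nonneg _) (norm_szP_lt t)

lemma hasSum_fc_szE (N : ℕ) (t : ℝ) (n : ℤ) :
    HasSum (fun j : ℕ => if n = ((N * (j + 1) : ℕ) : ℤ) then szP t ^ j else 0)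
      (fc (fun x => szE t (circ N x)) n) := by
  refine hasSum_fc (summable_norm_szP_pow t) (fun x => ?_) n
  simpa only [circ_pow] using hasSum_szE t (norm_circ N x)

lemma fc_conj_szE {N : ℕ} (hN : 0 < N) (t : ℝ) {n : ℤ} (hn : 0 ≤ n) :
    fc (fun x => (starRingEnd ℂ) (szE t (circ N x))) n = 0 := by
  have h : HasSum (fun j : ℕ => if n = -((N * (j + 1) : ℕ) : ℤ)
      then (starRingEnd ℂ) (szP t) ^ j else 0)
      (fc (fun x => (starRingEnd ℂ) (szE t (circ N x))) n) := by
    refine hasSum_fc ?_ (fun x => ?_) n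
    · simpa only [norm_pow, RCLike.norm_conj] using summable_norm_szP_pow t
    · have := (hasSum_szE t (norm_circ N x)).map (starRingEnd ℂ) Complex.continuous_conj
      simpa only [Function.comp_def, map_mul, map_pow, conj_circ_pow] using this
  refine h.unique ?_
  convert hasSum_zero using 2 with j
  rw [if_neg]
  have : 0 < N * (j + 1) := by positivity
  omega

/-- The rescaled solution `A u(A² t, N x)`. -/
def szV (A : ℝ) (N : ℕ) (t x : ℝ) : ℂ := A * szU (A ^ 2 * t) (circ N x)

lemma contDiff_szV (A : ℝ) (N : ℕ) :
    ContDiff ℝ (⊤ : ℕ∞) (fun q : ℝ × ℝ => szV A N q.1 q.2) := by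
  have h1 := contDiff_szB
  have h2 := contDiff_szC
  have h3 : ContDiff ℝ (⊤ : ℕ∞) (fun q : ℝ × ℝ => szE (A ^ 2 * q.1) (circ N q.2)) :=
    (contDiff_szE N).comp (g := fun q : ℝ × ℝ => szE q.1 (circ N q.2))
      (f := fun q : ℝ × ℝ => (A ^ 2 * q.1, q.2)) (by fun_prop)
  unfold szV szU
  fun_prop

lemma szV_periodic (A : ℝ) (N : ℕ) (t x : ℝ) : szV A N t (x + 2 * Real.pi) = szV A N t x := by
  have : circ N (x + 2 * Real.pi) = circ N x := by
    simp only [circ]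
    have e : Complex.I * N * ((x + 2 * Real.pi : ℝ) : ℂ)
        = Complex.I * N * x + N * (2 * Real.pi * Complex.I) := by push_cast; ring
    rw [e, Complex.exp_add, Complex.exp_nat_mul_two_pi_mul_I, mul_one]
  rw [szV, szV, this]

lemma fc_szV (A : ℝ) (N : ℕ) (t : ℝ) (n : ℤ) :
    fc (szV A N t) n = A * ((if n = 0 then szB (A ^ 2 * t) else 0) +
      szC (A ^ 2 * t) * fc (fun x => szE (A ^ 2 * t) (circ N x)) n) := by
  have hE : Continuous fun x => szE (A ^ 2 * t) (circ N x) :=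
    (contDiff_szE N).continuous.comp (Continuous.prodMk_right (A ^ 2 * t))
  have hc : fc (fun _ => szB (A ^ 2 * t)) n = if n = 0 then szB (A ^ 2 * t) else 0 := by
    have := fc_const_mul (szB (A ^ 2 * t)) (fun x => Complex.exp (Complex.I * (0 : ℤ) * x)) n
    rw [fc_exp] at this
    simpa using this
  unfold szV szU
  rw [fc_const_mul, fc_add (by fun_prop) (by fun_prop), fc_const_mul, hc]

lemma fc_szE_of_nonpos {N : ℕ} (hN : 0 < N) (t : ℝ) {n : ℤ} (hn : n ≤ 0) :
    fc (fun x => szE t (circ N x)) n = 0 := by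
  refine (hasSum_fc_szE N t n).unique ?_
  convert hasSum_zero using 2 with j
  rw [if_neg]
  have : 0 < N * (j + 1) := by positivity
  omega

lemma fc_szE_mul_succ {N : ℕ} (hN : 0 < N) (t : ℝ) (j : ℕ) :
    fc (fun x => szE t (circ N x)) ((N * (j + 1) : ℕ) : ℤ) = szP t ^ j := by
  refine (hasSum_fc_szE N t _).unique ?_
  convert hasSum_ite_eq j (szP t ^ j) using 2 with i
  have : ((N * (j + 1) : ℕ) : ℤ) = ((N * (i + 1) : ℕ) : ℤ) ↔ i = j := by
    rw [Nat.cast_inj, Nat.mul_right_inj hN.ne']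
    omega
  simp only [this]
  split_ifs with h
  · rw [h]
  · rfl

lemma fc_szE_of_notMem {N : ℕ} (t : ℝ) {n : ℤ}
    (hn : ∀ j : ℕ, n ≠ ((N * (j + 1) : ℕ) : ℤ)) :
    fc (fun x => szE t (circ N x)) n = 0 := by
  refine (hasSum_fc_szE N t n).unique ?_
  simpa only [if_neg (hn _)] using hasSum_zero

lemma hasDerivAt_fc_szV (A : ℝ) {N : ℕ} (hN : 0 < N) {n : ℤ} (hn : 0 ≤ n) (t : ℝ) :
    HasDerivAt (fun s => fc (szV A N s) n)
      (-Complex.I * fc (fun x => (Complex.normSq (szV A N t x) : ℂ) * szV A N t x) n) t := by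
  have hV := (contDiff_szV A N).continuous
  have hR : Continuous fun q : ℝ × ℝ => szR (A ^ 2 * q.1) (circ N q.2) :=
    (continuous_szR N).comp (g := fun q : ℝ × ℝ => szR q.1 (circ N q.2))
      (f := fun q : ℝ × ℝ => (A ^ 2 * q.1, q.2)) (by fun_prop)
  have hns : Continuous fun q : ℝ × ℝ => (Complex.normSq (szV A N q.1 q.2) : ℂ) * szV A N q.1 q.2 :=
    (Complex.continuous_ofReal.comp (Complex.continuous_normSq.comp hV)).mul hV
  have h := hasDerivAt_fc (F := szV A N) (F' := fun t x => -Complex.I *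
    ((Complex.normSq (szV A N t x) : ℂ) * szV A N t x + -A ^ 3 * szR (A ^ 2 * t) (circ N x)))
    hV (by fun_prop) (fun t x => ?_) n t
  · refine h.congr_deriv ?_
    have hns' := hns.comp (Continuous.prodMk_right t)
    have hR' := hR.comp (Continuous.prodMk_right t)
    have e : fc (fun x => szR (A ^ 2 * t) (circ N x)) n = 0 := by
      unfold szR
      rw [fc_const_mul, fc_conj_szE hN _ hn, mul_zero]
    have hadd := fc_add (f := fun x => (Complex.normSq (szV A N t x) : ℂ) * szV A N t x)
      (g := fun x => -A ^ 3 * szR (A ^ 2 * t) (circ N x)) hns' (continuous_const.mul hR') n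
    rw [fc_const_mul, hadd, fc_const_mul, e, mul_zero, add_zero]
  · have h1 := hasDerivAt_szU (A ^ 2 * t) (norm_circ N x)
    have h2 : HasDerivAt (fun s : ℝ => A ^ 2 * s) (A ^ 2) t := by
      simpa using (hasDerivAt_id t).const_mul (A ^ 2)
    refine ((h1.scomp t h2).const_mul (A : ℂ)).congr_deriv ?_
    simp only [szV, map_mul, Complex.normSq_ofReal, Complex.real_smul]
    push_cast
    ring

lemma szB_zero : szB 0 = 0 := by simp [szB, osc]

lemma norm_szB_pi_div : ‖szB (Real.pi / 39)‖ = 80 / 13 := by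
  have h : osc 64 (Real.pi / 39) = -osc 25 (Real.pi / 39) := by
    have e : -Complex.I * (64 : ℝ) * ((Real.pi / 39 : ℝ) : ℂ)
        = -Complex.I * (25 : ℝ) * ((Real.pi / 39 : ℝ) : ℂ) - Real.pi * Complex.I := by
      push_cast
      ring
    rw [osc, e, Complex.exp_sub, Complex.exp_pi_mul_I, osc, div_neg, div_one]
  have e : szB (Real.pi / 39) = -(80 / 13) * osc 25 (Real.pi / 39) := by
    rw [szB, h]
    ring
  rw [e, norm_mul, norm_osc]
  norm_num

/-- Weighted `ℓ²` bound for the data of the rescaled solution at time zero. -/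
lemma tsum_fc_szV_zero_le {δ : ℝ} (hδ : 0 < δ) (A : ℝ) {N : ℕ} (hN : 0 < N) :
    ∑' n : ℕ, (1 + (n : ℝ) ^ 2) ^ (-δ) * ‖fc (szV A N 0) (n : ℤ)‖ ^ 2
      ≤ ((N : ℝ) ^ 2) ^ (-δ) * A ^ 2 * (‖szC 0‖ ^ 2 * ∑' j : ℕ, (‖szP 0‖ ^ 2) ^ j) := by
  have hfc (n : ℤ) : fc (szV A N 0) n = A * (szC 0 * fc (fun x => szE 0 (circ N x)) n) := by
    rw [fc_szV]
    simp [szB_zero]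
  have hinj : Function.Injective fun j : ℕ => N * (j + 1) := by
    intro i j hij
    have := Nat.eq_of_mul_eq_mul_left hN hij
    omega
  rw [← hinj.tsum_eq]
  · have hp : ‖szP 0‖ ^ 2 < 1 := by nlinarith [norm_nonneg (szP 0), norm_szP_lt 0]
    have hs := summable_geometric_of_lt_one (sq_nonneg _) hp
    have hs' := (hs.mul_left (‖szC 0‖ ^ 2)).mul_left (((N : ℝ) ^ 2) ^ (-δ) * A ^ 2)
    rw [← tsum_mul_left, ← tsum_mul_left]
    have hle (j : ℕ) : (1 + ((N * (j + 1) : ℕ) : ℝ) ^ 2) ^ (-δ) *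
        ‖fc (szV A N 0) ((N * (j + 1) : ℕ) : ℤ)‖ ^ 2 ≤
        ((N : ℝ) ^ 2) ^ (-δ) * A ^ 2 * (‖szC 0‖ ^ 2 * (‖szP 0‖ ^ 2) ^ j) := by
      rw [hfc, fc_szE_mul_succ hN]
      have h1 : (1 + ((N * (j + 1) : ℕ) : ℝ) ^ 2) ^ (-δ) ≤ ((N : ℝ) ^ 2) ^ (-δ) := by
        refine Real.rpow_le_rpow_of_nonpos (by positivity) ?_ (by linarith)
        have : (N : ℝ) ≤ ((N * (j + 1) : ℕ) : ℝ) := by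
          exact_mod_cast Nat.le_mul_of_pos_right N (Nat.succ_pos j)
        have h0 : (0 : ℝ) ≤ N := by positivity
        nlinarith
      have h2 : ‖(A : ℂ) * (szC 0 * szP 0 ^ j)‖ ^ 2
          = A ^ 2 * (‖szC 0‖ ^ 2 * (‖szP 0‖ ^ 2) ^ j) := by
        rw [norm_mul, norm_mul, norm_pow, Complex.norm_real, mul_pow, mul_pow, Real.norm_eq_abs,
          sq_abs]
        ring
      rw [h2, mul_assoc]
      gcongr
    exact Summable.tsum_le_tsum hle (Summable.of_nonneg_of_le (fun j => by positivity) hle hs') hs'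
  · intro n hn
    by_contra hmem
    apply hn
    have : ∀ j : ℕ, (n : ℤ) ≠ ((N * (j + 1) : ℕ) : ℤ) := by
      intro j hj
      exact hmem ⟨j, (by exact_mod_cast hj.symm)⟩
    simp only [hfc, fc_szE_of_notMem 0 this]
    simp

/-- Norm inflation for the cubic Szegő equation: for every `δ > 0` there are smooth solutions
`v_k` (holomorphic, i.e. with vanishing negative Fourier coefficients) of the cubic Szegő
equation and positive times `t_k → 0` such that the `W^{−δ,2}` norm of `v_k(0)` tends to `0`
while `|v̂_k(t_k, 0)| → ∞`. -/
theorem stmt_11 (δ : ℝ) (hδ : 0 < δ) :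
    ∃ (v : ℕ → ℝ → ℝ → ℂ) (ts : ℕ → ℝ),
      (∀ k, ContDiff ℝ (⊤ : ℕ∞) (fun p : ℝ × ℝ => v k p.1 p.2)) ∧
      (∀ k t x, v k t (x + 2 * Real.pi) = v k t x) ∧
      (∀ k t, ∀ n : ℤ, n < 0 → fc (v k t) n = 0) ∧
      (∀ k, ∀ n : ℤ, 0 ≤ n → ∀ t : ℝ,
        HasDerivAt (fun s => fc (v k s) n)
          (-Complex.I * fc (fun x => (Complex.normSq (v k t x) : ℂ) * v k t x) n) t) ∧
      (∀ k, 0 < ts k) ∧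
      Tendsto ts atTop (nhds 0) ∧
      Tendsto (fun k => ∑' n : ℕ, (1 + (n : ℝ) ^ 2) ^ (-δ) * ‖fc (v k 0) (n : ℤ)‖ ^ 2)
        atTop (nhds 0) ∧
      Tendsto (fun k => ‖fc (v k (ts k)) 0‖) atTop atTop := by
  let A : ℕ → ℝ := fun k => k + 1
  let N : ℕ → ℕ := fun k => ⌈A k ^ (2 / δ)⌉₊
  have hA (k : ℕ) : 0 < A k := by positivity
  have hN (k : ℕ) : 0 < N k := Nat.ceil_pos.mpr (Real.rpow_pos_of_pos (hA k) _)
  have hAtop : Tendsto A atTop atTop :=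
    tendsto_atTop_add_const_right _ _ tendsto_natCast_atTop_atTop
  have hAsq : Tendsto (fun k => (A k ^ 2)⁻¹) atTop (nhds 0) :=
    tendsto_inv_atTop_zero.comp ((tendsto_pow_atTop two_ne_zero).comp hAtop)
  refine ⟨fun k => szV (A k) (N k), fun k => Real.pi / 39 * (A k ^ 2)⁻¹,
    fun k => contDiff_szV _ _, fun k => szV_periodic _ _, fun k t n hn => ?_,
    fun k n hn t => hasDerivAt_fc_szV _ (hN k) hn t, fun k => ?_, ?_, ?_, ?_⟩
  · rw [fc_szV, if_neg hn.ne, fc_szE_of_nonpos (hN k) _ hn.le]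
    simp
  · have := hA k
    positivity
  · simpa using hAsq.const_mul (Real.pi / 39)
  · have hlim := hAsq.mul_const (‖szC 0‖ ^ 2 * ∑' j : ℕ, (‖szP 0‖ ^ 2) ^ j)
    rw [zero_mul] at hlim
    refine squeeze_zero (fun k => tsum_nonneg fun n => by positivity) (fun k => ?_) hlim
    refine (tsum_fc_szV_zero_le hδ (A k) (hN k)).trans ?_
    have hS : 0 ≤ ∑' j : ℕ, (‖szP 0‖ ^ 2) ^ j := tsum_nonneg fun j => by positivity
    refine mul_le_mul_of_nonneg_right ?_ (by positivity)
    have hpow : ((A k ^ (2 / δ)) ^ 2) ^ (-δ) = (A k ^ 4)⁻¹ := by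
      rw [← Real.rpow_natCast, ← Real.rpow_mul (hA k).le, ← Real.rpow_mul (hA k).le,
        ← Real.rpow_natCast, ← Real.rpow_neg (hA k).le]
      congr 1
      push_cast
      field_simp
      norm_num
    have hle : ((N k : ℝ) ^ 2) ^ (-δ) ≤ (A k ^ 4)⁻¹ := by
      rw [← hpow]
      have h0 : 0 < A k ^ (2 / δ) := Real.rpow_pos_of_pos (hA k) _
      exact Real.rpow_le_rpow_of_nonpos (by positivity)
        (pow_le_pow_left₀ h0.le (Nat.le_ceil _) 2) (by linarith)
    calc ((N k : ℝ) ^ 2) ^ (-δ) * A k ^ 2 ≤ (A k ^ 4)⁻¹ * A k ^ 2 := by gcongr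
      _ = (A k ^ 2)⁻¹ := by
        have := (hA k).ne'
        field_simp
  · have e (k : ℕ) : ‖fc (szV (A k) (N k) (Real.pi / 39 * (A k ^ 2)⁻¹)) 0‖ = A k * (80 / 13) := by
      have hne : A k ^ 2 ≠ 0 := (pow_pos (hA k) 2).ne'
      have ht : A k ^ 2 * (Real.pi / 39 * (A k ^ 2)⁻¹) = Real.pi / 39 := by
        rw [mul_comm, mul_assoc, inv_mul_cancel₀ hne, mul_one]
      rw [fc_szV, fc_szE_of_nonpos (hN k) _ le_rfl, ht, if_pos rfl, mul_zero, add_zero, norm_mul,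
        norm_szB_pi_div, Complex.norm_real, Real.norm_of_nonneg (hA k).le]
    simp only [e]
    exact hAtop.atTop_mul_const (by norm_num)
end
end

section
/- Let φ ∈ L²(𝕋) be real-valued, and suppose that finitely supported sequences are dense in Dom T_φ with respect to the graph norm (i.e. [T_φ]_max = [T_φ]_min). Then the maximal Toeplitz operator T_φ is self-adjoint: for all f, h ∈ ℓ², ⟨T_φ g, f⟩ = ⟨g, h⟩ holds for every g ∈ Dom T_φ if and only if f ∈ Dom T_φ and T_φ f = h. -/
open scoped ComplexConjugate
open Filter MeasureTheory AddCircle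

noncomputable section

instance : Fact (0 < 2 * Real.pi) := ⟨by positivity⟩

/-- `ℓ²(ℕ, ℂ)`. -/
abbrev ellTwo : Type := lp (fun _ : ℕ => ℂ) 2

/-- The `ℓ²` inner product, linear in the first argument. -/
def ip (f g : ℕ → ℂ) : ℂ := ∑' n : ℕ, f n * conj (g n)

/-- Finitely supported sequences. -/
def FinSupp (p : ℕ → ℂ) : Prop := ∃ N, ∀ n ≥ N, p n = 0

/-- The (maximal) Toeplitz matrix action with symbol coefficients `a : ℤ → ℂ`:
`(T f)(j) = ∑_k a(j−k) f(k)`. -/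
def toeplitz (a : ℤ → ℂ) (f : ℕ → ℂ) : ℕ → ℂ :=
  fun j => ∑' k : ℕ, a ((j : ℤ) - (k : ℤ)) * f k

theorem memℓp_fourierCoeff (φ : Lp ℂ 2 (haarAddCircle (T := 2 * Real.pi))) :
    Memℓp (fourierCoeff ⇑φ) 2 := by
  have h := lp.memℓp (fourierBasis.repr φ)
  have e : (⇑(fourierBasis.repr φ) : ℤ → ℂ) = fourierCoeff ⇑φ := funext (fourierBasis_repr φ)
  rwa [e] at h

theorem fourierCoeff_neg_of_real {f : AddCircle (2 * Real.pi) → ℂ}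
    (hf : ∀ᵐ x ∂(haarAddCircle (T := 2 * Real.pi)), (f x).im = 0) (n : ℤ) :
    fourierCoeff f (-n) = conj (fourierCoeff f n) := by
  unfold fourierCoeff
  rw [← integral_conj]
  refine integral_congr_ae ?_
  filter_upwards [hf] with x hx
  rw [smul_eq_mul, smul_eq_mul, map_mul, fourier_neg, fourier_neg, Complex.conj_eq_iff_im.mpr hx]

/-- The columns of a Toeplitz matrix with square-summable symbol are square-summable. -/
theorem memℓp_toeplitz_column {a : ℤ → ℂ} (ha : Memℓp a 2) (k : ℕ) :
    Memℓp (fun j : ℕ => a ((j : ℤ) - (k : ℤ))) 2 := by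
  have h2 : 0 < (2 : ENNReal).toReal := by norm_num
  refine memℓp_gen ?_
  have h : Function.Injective (fun j : ℕ => (j : ℤ) - (k : ℤ)) := by
    intro i j hij
    simpa using hij
  exact (ha.summable h2).comp_injective h

theorem ip_eq_inner (f g : ellTwo) : ip f g = inner ℂ g f := by
  rw [lp.inner_eq_tsum]
  rfl

theorem summable_mul_conj (f g : ellTwo) : Summable fun n => f n * conj (g n) :=
  lp.summable_inner g f

theorem norm_ip_le (f g : ellTwo) : ‖ip f g‖ ≤ ‖f‖ * ‖g‖ := by
  rw [ip_eq_inner, mul_comm]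
  exact norm_inner_le_norm g f

theorem ip_sub_left (f g h : ellTwo) : ip ⇑(f - g) h = ip f h - ip g h := by
  simp only [ip_eq_inner, inner_sub_right]

/-- Pairing with a column of a Hermitian Toeplitz matrix. -/
theorem tsum_toeplitz_column_mul_conj {a : ℤ → ℂ} (hconj : ∀ n, a (-n) = conj (a n))
    (f : ℕ → ℂ) (k : ℕ) :
    ∑' j : ℕ, a ((j : ℤ) - (k : ℤ)) * conj (f j) = conj (toeplitz a f k) := by
  rw [toeplitz, Complex.conj_tsum]
  refine tsum_congr fun j => ?_
  rw [map_mul, ← hconj, neg_sub]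

theorem toeplitz_single (a : ℤ → ℂ) (k : ℕ) :
    toeplitz a (Pi.single k 1) = fun j : ℕ => a ((j : ℤ) - (k : ℤ)) := by
  funext j
  rw [toeplitz, tsum_eq_single k]
  · simp
  · intro i hi
    simp [hi]

/-- A Hermitian Toeplitz matrix is symmetric against finitely supported sequences. -/
theorem ip_toeplitz_of_finSupp {a : ℤ → ℂ} (ha : Memℓp a 2) (hconj : ∀ n, a (-n) = conj (a n))
    {p : ℕ → ℂ} (hp : FinSupp p) (f : ellTwo) :
    ip (toeplitz a p) f = ip p (toeplitz a f) := by
  obtain ⟨N, hN⟩ := hp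
  have hz : ∀ k ∉ Finset.range N, p k = 0 := fun k hk => hN k (by simpa using hk)
  have hT : ∀ j, toeplitz a p j = ∑ k ∈ Finset.range N, a ((j : ℤ) - (k : ℤ)) * p k := fun j =>
    tsum_eq_sum fun k hk => by rw [hz k hk, mul_zero]
  have hs : ∀ k : ℕ, Summable fun j : ℕ => a ((j : ℤ) - (k : ℤ)) * conj (f j) := fun k =>
    summable_mul_conj ⟨_, memℓp_toeplitz_column ha k⟩ f
  calc ip (toeplitz a p) f
      = ∑' j : ℕ, ∑ k ∈ Finset.range N, p k * (a ((j : ℤ) - (k : ℤ)) * conj (f j)) := by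
        refine tsum_congr fun j => ?_
        rw [hT, Finset.sum_mul]
        exact Finset.sum_congr rfl fun k _ => by ring
    _ = ∑ k ∈ Finset.range N, ∑' j : ℕ, p k * (a ((j : ℤ) - (k : ℤ)) * conj (f j)) :=
        Summable.tsum_finsetSum fun k _ => (hs k).mul_left _
    _ = ∑ k ∈ Finset.range N, p k * conj (toeplitz a f k) := by
        refine Finset.sum_congr rfl fun k _ => ?_
        rw [tsum_mul_left, tsum_toeplitz_column_mul_conj hconj]
    _ = ip p (toeplitz a f) :=
        (tsum_eq_sum fun k hk => by rw [hz k hk, zero_mul]).symm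

/-- If `φ ∈ L²(𝕋)` is real valued and finitely supported sequences are dense in `Dom T_φ`
for the graph norm (`[T_φ]_max = [T_φ]_min`), then the maximal Toeplitz operator `T_φ` is
self-adjoint: `⟨T_φ g, f⟩ = ⟨g, h⟩` for all `g ∈ Dom T_φ` iff `f ∈ Dom T_φ` and `T_φ f = h`. -/
theorem stmt_12 (φ : Lp ℂ 2 (haarAddCircle (T := 2 * Real.pi)))
    (hreal : ∀ᵐ x ∂(haarAddCircle (T := 2 * Real.pi)), ((⇑φ) x).im = 0)
    (hdense : ∀ (f : ellTwo) (hf : Memℓp (toeplitz (fourierCoeff ⇑φ) (⇑f)) 2)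
      (ε : ℝ), 0 < ε →
      ∃ (p : ellTwo) (_ : FinSupp (⇑p)) (hp : Memℓp (toeplitz (fourierCoeff ⇑φ) (⇑p)) 2),
        ‖f - p‖ ^ 2 +
          ‖(⟨toeplitz (fourierCoeff ⇑φ) (⇑f), hf⟩ : ellTwo) -
            (⟨toeplitz (fourierCoeff ⇑φ) (⇑p), hp⟩ : ellTwo)‖ ^ 2 < ε ^ 2) :
    ∀ f h : ellTwo,
      (∀ g : ellTwo, Memℓp (toeplitz (fourierCoeff ⇑φ) (⇑g)) 2 →
          ip (toeplitz (fourierCoeff ⇑φ) (⇑g)) (⇑f) = ip (⇑g) (⇑h)) ↔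
        (Memℓp (toeplitz (fourierCoeff ⇑φ) (⇑f)) 2 ∧
          toeplitz (fourierCoeff ⇑φ) (⇑f) = ⇑h) := by
  have ha := memℓp_fourierCoeff φ
  have hconj := fourierCoeff_neg_of_real hreal
  generalize fourierCoeff ⇑φ = a at *
  intro f h
  constructor
  · intro H
    have hT : toeplitz a f = h := by
      funext k
      have hk : ⇑(lp.single 2 k (1 : ℂ) : ellTwo) = Pi.single k 1 := lp.coeFn_single 2 k 1
      have H' := H (lp.single 2 k 1) (by
        rw [hk, toeplitz_single]
        exact memℓp_toeplitz_column ha k)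
      rw [hk, toeplitz_single] at H'
      have hr : ip (Pi.single k 1) h = conj (h k) := by
        rw [ip, tsum_eq_single k]
        · simp
        · intro i hi
          simp [hi]
      rw [hr, ip, tsum_toeplitz_column_mul_conj hconj] at H'
      exact star_injective H'
    exact ⟨hT ▸ lp.memℓp h, hT⟩
  · rintro ⟨-, hT⟩ g hg
    refine eq_of_forall_dist_le fun δ hδ => ?_
    obtain ⟨ε, hε, hεδ⟩ : ∃ ε : ℝ, 0 < ε ∧ ε * (‖f‖ + ‖h‖) ≤ δ := by
      refine ⟨δ / (‖f‖ + ‖h‖ + 1), by positivity, ?_⟩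
      rw [div_mul_eq_mul_div, div_le_iff₀ (by positivity)]
      nlinarith [norm_nonneg f, norm_nonneg h]
    obtain ⟨p, hfin, hp, hlt⟩ := hdense g hg ε hε
    set Tg : ellTwo := ⟨toeplitz a g, hg⟩
    set Tp : ellTwo := ⟨toeplitz a p, hp⟩
    have h1 : ‖g - p‖ ≤ ε := abs_le_of_sq_le_sq' (by nlinarith [sq_nonneg ‖Tg - Tp‖]) hε.le |>.2
    have h2 : ‖Tg - Tp‖ ≤ ε := abs_le_of_sq_le_sq' (by nlinarith [sq_nonneg ‖g - p‖]) hε.le |>.2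
    have hsymm : ip Tp f = ip p h := hT ▸ ip_toeplitz_of_finSupp ha hconj hfin f
    have key : ip Tg f - ip g h = ip ⇑(Tg - Tp) f - ip ⇑(g - p) h := by
      rw [ip_sub_left, ip_sub_left, hsymm]
      ring
    change dist (ip Tg f) (ip g h) ≤ δ
    rw [dist_eq_norm, key]
    calc _ ≤ ‖Tg - Tp‖ * ‖f‖ + ‖g - p‖ * ‖h‖ :=
          (norm_sub_le _ _).trans (add_le_add (norm_ip_le _ _) (norm_ip_le _ _))
      _ ≤ ε * ‖f‖ + ε * ‖h‖ := by gcongr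
      _ ≤ δ := by linarith
end
end

section
/- Let φ ∈ L²(𝕋) be real-valued, and suppose that finitely supported sequences are dense in Dom T_φ with respect to the graph norm (i.e. [T_φ]_max = [T_φ]_min). If there exists f ∈ Dom T_φ with f ≠ 0 and T_φ f = 0, then φ = 0 almost everywhere on 𝕋. Equivalently, the kernel of [T_φ]_max is trivial unless φ is identically zero. -/
open scoped ComplexConjugate
open Filter MeasureTheory AddCircle

noncomputable section

section Fourier

variable {T : ℝ} [hT : Fact (0 < T)]

/-- An integrable function on the circle whose Fourier coefficients all vanish is zero a.e. -/
theorem ae_eq_zero_of_fourierCoeff_eq_zero {f : AddCircle T → ℂ}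
    (hf : Integrable f haarAddCircle) (h : ∀ n, fourierCoeff f n = 0) :
    f =ᵐ[haarAddCircle] 0 := by
  have hgf_int : ∀ g : C(AddCircle T, ℂ), Integrable (fun t => g t * f t) haarAddCircle := fun g =>
    hf.bdd_mul (c := ‖g‖) (map_continuous g).aestronglyMeasurable
      (ae_of_all _ fun t => g.norm_coe_le_norm t)
  have hcont : ∀ g : C(AddCircle T, ℂ), ∫ t, g t * f t ∂haarAddCircle = 0 := by
    let L : C(AddCircle T, ℂ) →ₗ[ℂ] ℂ :=
      { toFun := fun g => ∫ t, g t * f t ∂haarAddCircle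
        map_add' := fun g₁ g₂ => by
          simpa [add_mul] using integral_add (hgf_int g₁) (hgf_int g₂)
        map_smul' := fun c g => by
          simp [mul_assoc, integral_const_mul] }
    let L' : C(AddCircle T, ℂ) →L[ℂ] ℂ :=
      L.mkContinuous (∫ t, ‖f t‖ ∂haarAddCircle) (fun g => by
        change ‖∫ t, g t * f t ∂haarAddCircle‖ ≤ _
        refine (norm_integral_le_integral_norm _).trans ?_
        rw [mul_comm, ← integral_const_mul]
        refine integral_mono (hgf_int g).norm (hf.norm.const_mul _) fun t => ?_
        simp only [norm_mul]
        gcongr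
        exact g.norm_coe_le_norm t)
    have hker : (Submodule.span ℂ (Set.range (@fourier T))).topologicalClosure ≤ L'.ker := by
      refine Submodule.topologicalClosure_minimal _ ?_ L'.isClosed_ker
      rw [Submodule.span_le]
      rintro _ ⟨n, rfl⟩
      have := h (-n)
      rw [fourierCoeff, neg_neg] at this
      exact this
    intro g
    have hg : g ∈ L'.ker := hker (by rw [span_fourier_closure_eq_top]; trivial)
    exact hg
  refine ae_eq_zero_of_forall_setIntegral_isClosed_eq_zero hf fun s hs => ?_
  have hlim : Tendsto (fun n => ∫ t, ((hs.apprSeq n t : ℝ) : ℂ) * f t ∂haarAddCircle) atTop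
      (nhds (∫ t, s.indicator f t ∂haarAddCircle)) := by
    refine tendsto_integral_of_dominated_convergence (fun t => ‖f t‖) (fun n => ?_) hf.norm
      (fun n => ae_of_all _ fun t => ?_) (ae_of_all _ fun t => ?_)
    · exact (hgf_int ⟨fun t => ((hs.apprSeq n t : ℝ) : ℂ), by fun_prop⟩).aestronglyMeasurable
    · rw [norm_mul]
      refine mul_le_of_le_one_left (norm_nonneg _) ?_
      have := HasOuterApproxClosed.apprSeq_apply_le_one hs n t
      simpa using this
    · have h1 := tendsto_pi_nhds.1 (HasOuterApproxClosed.tendsto_apprSeq hs) t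
      have h2 : Tendsto (fun n => ((hs.apprSeq n t : ℝ) : ℂ) * f t) atTop
          (nhds ((((s.indicator (fun _ => (1 : NNReal)) t : NNReal) : ℝ) : ℂ) * f t)) :=
        ((Complex.continuous_ofReal.tendsto _).comp
          ((NNReal.continuous_coe.tendsto _).comp h1)).mul_const _
      convert! h2 using 2
      by_cases hts : t ∈ s <;> simp [hts]
  rw [← integral_indicator hs.measurableSet]
  refine tendsto_nhds_unique hlim ?_
  have : ∀ n, ∫ t, ((hs.apprSeq n t : ℝ) : ℂ) * f t ∂haarAddCircle = 0 := fun n =>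
    hcont ⟨fun t => ((hs.apprSeq n t : ℝ) : ℂ), by fun_prop⟩
  simp [this]

theorem fourierCoeff_conj (f : AddCircle T → ℂ) (n : ℤ) :
    fourierCoeff (fun t => conj (f t)) n = conj (fourierCoeff f (-n)) := by
  simp only [fourierCoeff, ← integral_conj, smul_eq_mul, map_mul, fourier_neg, neg_neg]

/-- The Fourier coefficients of a product of two `L²` functions are given by convolution. -/
theorem hasSum_fourierCoeff_mul {F G : AddCircle T → ℂ} (hF : MemLp F 2 haarAddCircle)
    (hG : MemLp G 2 haarAddCircle) (n : ℤ) :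
    HasSum (fun k : ℤ => fourierCoeff F (n - k) * fourierCoeff G k)
      (fourierCoeff (fun t => F t * G t) n) := by
  have hX : MemLp (fun t => conj (F t) * fourier n t) 2 haarAddCircle := by
    have h1 : MemLp (fun t => conj (F t)) 2 haarAddCircle := hF.star
    refine h1.mono (h1.1.mul (map_continuous (fourier n)).aestronglyMeasurable)
      (ae_of_all _ fun t => ?_)
    simp only [norm_mul, fourier_apply, Circle.norm_coe, mul_one, le_refl]
  have hX' : ∀ᵐ t ∂haarAddCircle, (hX.toLp _ : AddCircle T → ℂ) t = conj (F t) * fourier n t :=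
    hX.coeFn_toLp
  have hG' := hG.coeFn_toLp
  have key := (@fourierBasis T hT).hasSum_inner_mul_inner (hX.toLp _) (hG.toLp _)
  convert! key using 1
  · ext k
    congr 1
    · rw [coe_fourierBasis, L2.inner_def, fourierCoeff]
      refine integral_congr_ae ?_
      filter_upwards [hX', coeFn_fourierLp 2 k] with t h1 h2
      rw [h1, h2]
      simp only [RCLike.inner_apply, map_mul, Complex.conj_conj, smul_eq_mul, ← fourier_neg]
      rw [neg_sub, sub_eq_add_neg, fourier_add]
      ring
    · rw [← HilbertBasis.repr_apply_apply, fourierBasis_repr]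
      exact congrFun (fourierCoeff_congr_ae hG'.symm) k
  · rw [L2.inner_def, fourierCoeff]
    refine integral_congr_ae ?_
    filter_upwards [hX', hG'] with t h1 h2
    rw [h1, h2]
    simp only [RCLike.inner_apply, map_mul, Complex.conj_conj, smul_eq_mul, ← fourier_neg]
    ring

end Fourier

section Sequences

/-- The bi-infinite Toeplitz matrix action `∑_k b(n−k) f(k)`, for all `n : ℤ`. -/
def intToeplitz (b : ℤ → ℂ) (f : ℕ → ℂ) (n : ℤ) : ℂ := ∑' k : ℕ, b (n - k) * f k

theorem memℓp_two_iff {ι : Type*} {f : ι → ℂ} : Memℓp f 2 ↔ Summable fun i => ‖f i‖ ^ 2 := by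
  rw [memℓp_gen_iff (by norm_num)]
  norm_num

/-- The conjugated `n`-th row of the Toeplitz matrix, as an element of `ℓ²`. -/
def toeplitzRow (b : ℤ → ℂ) (hb : Memℓp b 2) (n : ℤ) : ellTwo :=
  ⟨fun k => conj (b (n - k)), by
    rw [memℓp_two_iff] at hb
    have hinj : Function.Injective fun k : ℕ => n - (k : ℤ) := fun k l h => by
      simpa using h
    exact memℓp_two_iff.2 (by simpa [Function.comp_def] using hb.comp_injective hinj)⟩

variable {b : ℤ → ℂ}

theorem hasSum_intToeplitz (hb : Memℓp b 2) (f : ellTwo) (n : ℤ) :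
    HasSum (fun k : ℕ => b (n - k) * f k) (inner ℂ (toeplitzRow b hb n) f) := by
  convert! lp.hasSum_inner (𝕜 := ℂ) (toeplitzRow b hb n) f using 2 with k
  simp [toeplitzRow, mul_comm]

theorem inner_toeplitzRow (hb : Memℓp b 2) (f : ellTwo) (n : ℤ) :
    inner ℂ (toeplitzRow b hb n) f = intToeplitz b f n :=
  (hasSum_intToeplitz hb f n).tsum_eq.symm

/-- The sequence `0, f 0, f 1, …`. -/
def shiftSeq (f : ℕ → ℂ) : ℕ → ℂ
  | 0 => 0
  | n + 1 => f n

/-- The unilateral shift. -/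
def shift (f : ellTwo) : ellTwo :=
  ⟨shiftSeq f, memℓp_two_iff.2 ((summable_nat_add_iff (f := fun n => ‖shiftSeq f n‖ ^ 2) 1).1
    (memℓp_two_iff.1 (lp.memℓp f)))⟩

/-- The backward shift. -/
def backwardShift (f : ellTwo) : ellTwo :=
  ⟨fun n => f (n + 1), memℓp_two_iff.2
    ((summable_nat_add_iff (f := fun n => ‖f n‖ ^ 2) 1).2 (memℓp_two_iff.1 (lp.memℓp f)))⟩

theorem shift_zero (f : ellTwo) : shift f 0 = 0 := rfl

theorem shift_succ (f : ellTwo) (n : ℕ) : shift f (n + 1) = f n := rfl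

theorem backwardShift_apply (f : ellTwo) (n : ℕ) : backwardShift f n = f (n + 1) := rfl

theorem shift_backwardShift {f : ellTwo} (hf : f 0 = 0) : shift (backwardShift f) = f := by
  ext n
  cases n with
  | zero => rw [shift_zero, hf]
  | succ n => rw [shift_succ, backwardShift_apply]

theorem intToeplitz_shift (hb : Memℓp b 2) (f : ellTwo) (n : ℤ) :
    intToeplitz b (shift f) n = intToeplitz b f (n - 1) := by
  rw [intToeplitz, (hasSum_intToeplitz hb (shift f) n).summable.tsum_eq_zero_add]
  simp only [shift_zero, shift_succ, mul_zero, zero_add, intToeplitz]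
  refine tsum_congr fun k => ?_
  congr 2
  push_cast
  ring

theorem intToeplitz_iterate_shift (hb : Memℓp b 2) (f : ellTwo) (n : ℤ) (m : ℕ) :
    intToeplitz b (shift^[m] f) n = intToeplitz b f (n - m) := by
  induction m generalizing n with
  | zero => simp
  | succ m ih =>
    rw [Function.iterate_succ_apply', intToeplitz_shift hb, ih]
    congr 1
    push_cast
    ring

/-- The kernel of the maximal Toeplitz operator. -/
def toeplitzKer (b : ℤ → ℂ) (hb : Memℓp b 2) : Submodule ℂ ellTwo :=
  (Submodule.span ℂ (Set.range fun j : ℕ => toeplitzRow b hb j))ᗮ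

theorem mem_toeplitzKer {hb : Memℓp b 2} {f : ellTwo} :
    f ∈ toeplitzKer b hb ↔ ∀ j : ℕ, intToeplitz b f j = 0 := by
  simp only [← inner_toeplitzRow hb]
  refine ⟨fun h j => h _ (Submodule.subset_span ⟨j, rfl⟩), fun h u hu => ?_⟩
  induction hu using Submodule.span_induction with
  | mem x hx => obtain ⟨j, rfl⟩ := hx; exact h j
  | zero => simp
  | add x y _ _ hx hy => rw [inner_add_left, hx, hy, add_zero]
  | smul c x _ hx => rw [inner_smul_left, hx, mul_zero]

theorem backwardShift_mem_toeplitzKer {hb : Memℓp b 2} {f : ellTwo}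
    (hf : f ∈ toeplitzKer b hb) (h0 : f 0 = 0) : backwardShift f ∈ toeplitzKer b hb := by
  rw [mem_toeplitzKer] at hf ⊢
  intro j
  have := hf (j + 1)
  rw [← shift_backwardShift h0, intToeplitz_shift hb] at this
  simpa using this

theorem exists_mem_toeplitzKer_apply_zero_ne_zero {hb : Memℓp b 2} {f : ellTwo}
    (hf : f ∈ toeplitzKer b hb) (hne : f ≠ 0) : ∃ h ∈ toeplitzKer b hb, h 0 ≠ 0 := by
  by_contra! H
  have hall : ∀ (n : ℕ), ∀ g ∈ toeplitzKer b hb, g n = 0 := by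
    intro n
    induction n with
    | zero => exact H
    | succ n ih =>
      intro g hg
      exact ih _ (backwardShift_mem_toeplitzKer hg (H g hg))
  exact hne (by ext n; exact hall n f hf)

/-- If the symbol is real, the image of a finitely supported sequence is orthogonal to the
kernel of the maximal Toeplitz operator. -/
theorem inner_toeplitz_eq_zero_of_finSupp {hb : Memℓp b 2} (hsymm : ∀ n, b (-n) = conj (b n))
    {h : ellTwo} (hh : h ∈ toeplitzKer b hb) {p : ℕ → ℂ} (hp : FinSupp p)
    (hTp : Memℓp (toeplitz b p) 2) : inner ℂ h (⟨toeplitz b p, hTp⟩ : ellTwo) = 0 := by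
  obtain ⟨N, hN⟩ := hp
  have hrow : ∀ k : ℕ, HasSum (fun j : ℕ => conj (h j) * b (j - k) * p k) 0 := by
    intro k
    have h1 := hasSum_intToeplitz hb h k
    rw [inner_toeplitzRow hb, mem_toeplitzKer.1 hh k] at h1
    have h2 := ((Complex.hasSum_conj' (f := fun j : ℕ => b (k - j) * h j)).2
      (by simpa using h1)).mul_right (p k)
    simp only [map_zero, zero_mul, map_mul, ← hsymm, neg_sub] at h2
    simpa only [mul_comm (conj _)] using h2
  have hsum := hasSum_sum (s := Finset.range N) fun k _ => hrow k
  rw [lp.inner_eq_tsum, ← Finset.sum_const_zero (s := Finset.range N) (M := ℂ), ← hsum.tsum_eq]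
  refine tsum_congr fun j => ?_
  simp only [RCLike.inner_apply, toeplitz]
  rw [tsum_eq_sum (s := Finset.range N)
    fun k hk => by rw [hN k (by simpa using hk), mul_zero], Finset.sum_mul]
  exact Finset.sum_congr rfl fun k _ => by ring

end Sequences

/-- If finitely supported sequences are dense in the domain of a Toeplitz operator with real symbol
and not all elements of its kernel vanish at `0`, then the kernel is invariant under the shift. -/
theorem shift_mem_toeplitzKer {b : ℤ → ℂ} {hb : Memℓp b 2} (hsymm : ∀ n, b (-n) = conj (b n))
    (hdense : ∀ (f : ellTwo) (hf : Memℓp (toeplitz b (⇑f)) 2) (ε : ℝ), 0 < ε →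
      ∃ (p : ellTwo) (_ : FinSupp (⇑p)) (hp : Memℓp (toeplitz b (⇑p)) 2),
        ‖f - p‖ ^ 2 +
          ‖(⟨toeplitz b (⇑f), hf⟩ : ellTwo) - (⟨toeplitz b (⇑p), hp⟩ : ellTwo)‖ ^ 2 < ε ^ 2)
    {f h : ellTwo} (hf : f ∈ toeplitzKer b hb) (hh : h ∈ toeplitzKer b hb) (h0 : h 0 ≠ 0) :
    shift f ∈ toeplitzKer b hb := by
  set c := intToeplitz b (shift f) 0 with hc
  have hsucc : ∀ j : ℕ, intToeplitz b (shift f) ((j + 1 : ℕ) : ℤ) = 0 := fun j => by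
    rw [intToeplitz_shift hb, ← mem_toeplitzKer.1 hf j]
    congr 1
    push_cast
    ring
  have heq : toeplitz b (shift f) = ⇑(lp.single 2 0 c : ellTwo) := by
    ext j
    rw [lp.coeFn_single]
    cases j with
    | zero => simp [hc, toeplitz, intToeplitz]
    | succ j =>
      rw [Pi.single_eq_of_ne j.succ_ne_zero]
      exact hsucc j
  have hmem : Memℓp (toeplitz b (shift f)) 2 := heq ▸ lp.memℓp _
  have hsub : (⟨toeplitz b (shift f), hmem⟩ : ellTwo) = lp.single 2 0 c := Subtype.ext heq
  have hbound : ∀ ε : ℝ, 0 < ε → ‖c * conj (h 0)‖ ≤ ‖h‖ * ε := by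
    intro ε hε
    obtain ⟨p, hp, hTp, hlt⟩ := hdense (shift f) hmem ε hε
    have hle : ‖(⟨toeplitz b (shift f), hmem⟩ : ellTwo) - ⟨toeplitz b p, hTp⟩‖ ≤ ε :=
      (abs_le_of_sq_le_sq' (by nlinarith [sq_nonneg ‖shift f - p‖]) hε.le).2
    have hinner : inner ℂ h ((⟨toeplitz b (shift f), hmem⟩ : ellTwo) - ⟨toeplitz b p, hTp⟩)
        = c * conj (h 0) := by
      rw [inner_sub_right, inner_toeplitz_eq_zero_of_finSupp hsymm hh hp hTp, sub_zero, hsub,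
        lp.inner_single_right, RCLike.inner_apply]
    rw [← hinner]
    exact (norm_inner_le_norm _ _).trans (by gcongr)
  have hzero : c * conj (h 0) = 0 := by
    rw [← norm_le_zero_iff]
    have hlim : Tendsto (fun ε : ℝ => ‖h‖ * ε) (nhdsWithin 0 (Set.Ioi 0)) (nhds 0) := by
      have : Tendsto (fun ε : ℝ => ‖h‖ * ε) (nhds 0) (nhds (‖h‖ * 0)) :=
        (continuous_const.mul continuous_id).tendsto 0
      simpa using this.mono_left nhdsWithin_le_nhds
    exact ge_of_tendsto hlim (eventually_nhdsWithin_of_forall hbound)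
  have hc0 : c = 0 := (mul_eq_zero.1 hzero).resolve_right (by simpa using h0)
  refine mem_toeplitzKer.2 fun j => ?_
  cases j with
  | zero => exact hc0
  | succ j => exact hsucc j

section Hardy

variable {T : ℝ} [hT : Fact (0 < T)]

theorem memℓp_fourierCoeff_s13 {F : AddCircle T → ℂ} (hF : MemLp F 2 haarAddCircle) :
    Memℓp (fourierCoeff F) 2 := by
  have h := memℓp_two_iff.2 (hasSum_sq_fourierCoeff (hF.toLp F)).summable
  rwa [fourierCoeff_congr_ae hF.coeFn_toLp] at h

/-- Every sequence in `ℓ²(ℕ)` is the sequence of Fourier coefficients of a function in the Hardy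
space `H²`. -/
theorem exists_hardy_fourierCoeff (g : ellTwo) : ∃ G : AddCircle T → ℂ, MemLp G 2 haarAddCircle ∧
    (∀ k : ℕ, fourierCoeff G k = g k) ∧ ∀ n : ℤ, n ∉ Set.range ((↑) : ℕ → ℤ) →
      fourierCoeff G n = 0 := by
  have hinj : Function.Injective ((↑) : ℕ → ℤ) := Nat.cast_injective
  have hmem : Memℓp (Function.extend ((↑) : ℕ → ℤ) g 0) 2 := by
    rw [memℓp_two_iff, ← hinj.summable_iff fun n hn => ?_]
    · simpa [Function.comp_def, hinj.extend_apply] using memℓp_two_iff.1 (lp.memℓp g)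
    · rw [Function.extend_apply' _ _ _ hn]
      simp
  refine ⟨(@fourierBasis T hT).repr.symm ⟨_, hmem⟩, Lp.memLp _, fun k => ?_, fun n hn => ?_⟩
  · rw [← fourierBasis_repr, LinearIsometryEquiv.apply_symm_apply]
    exact hinj.extend_apply _ _ _
  · rw [← fourierBasis_repr, LinearIsometryEquiv.apply_symm_apply]
    exact Function.extend_apply' _ _ _ hn

theorem fourierCoeff_mul_eq_intToeplitz {F G : AddCircle T → ℂ} (hF : MemLp F 2 haarAddCircle)
    (hG : MemLp G 2 haarAddCircle) {g : ℕ → ℂ} (hg : ∀ k : ℕ, fourierCoeff G k = g k)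
    (hneg : ∀ n : ℤ, n ∉ Set.range ((↑) : ℕ → ℤ) → fourierCoeff G n = 0) (n : ℤ) :
    fourierCoeff (fun t => F t * G t) n = intToeplitz (fourierCoeff F) g n := by
  rw [← (hasSum_fourierCoeff_mul hF hG n).tsum_eq, intToeplitz]
  rw [← (Nat.cast_injective (R := ℤ)).tsum_eq]
  · simp only [hg]
  · intro k hk
    by_contra hk'
    exact hk (by simp [hneg k hk'])

/-- A function in `H²` that is orthogonal to all its proper shifts has constant modulus. -/
theorem ae_conj_mul_self_eq_of_inner_iterate_shift {G : AddCircle T → ℂ}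
    (hG : MemLp G 2 haarAddCircle) {g : ellTwo} (hg : ∀ k : ℕ, fourierCoeff G k = g k)
    (hneg : ∀ n : ℤ, n ∉ Set.range ((↑) : ℕ → ℤ) → fourierCoeff G n = 0)
    (horth : ∀ m : ℕ, inner ℂ g (shift^[m + 1] g) = 0) :
    ∃ C : ℂ, ∀ᵐ t ∂haarAddCircle, conj (G t) * G t = C := by
  set H : AddCircle T → ℂ := fun t => conj (G t) * G t with hH
  have hGc : MemLp (fun t => conj (G t)) 2 haarAddCircle := hG.star
  have hgf_int : Integrable H haarAddCircle := hGc.integrable_mul hG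
  have hminus : ∀ m : ℕ, fourierCoeff H (-((m + 1 : ℕ) : ℤ)) = 0 := by
    intro m
    have hc := memℓp_fourierCoeff_s13 hGc
    rw [hH, fourierCoeff_mul_eq_intToeplitz hGc hG hg hneg, ← zero_sub,
      ← intToeplitz_iterate_shift hc, ← horth m, lp.inner_eq_tsum]
    refine tsum_congr fun k => ?_
    rw [fourierCoeff_conj, zero_sub, neg_neg, hg, RCLike.inner_apply, mul_comm]
  have hconj : ∀ n : ℤ, fourierCoeff H n = conj (fourierCoeff H (-n)) := by
    intro n
    rw [← fourierCoeff_conj]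
    congr 1
    ext t
    simp [hH, mul_comm]
  have hne : ∀ n : ℤ, n ≠ 0 → fourierCoeff H n = 0 := by
    intro n hn
    obtain ⟨m, rfl | rfl⟩ := Int.eq_nat_or_neg n
    · obtain ⟨m, rfl⟩ := Nat.exists_eq_succ_of_ne_zero (by simpa using hn)
      rw [hconj, hminus, map_zero]
    · obtain ⟨m, rfl⟩ := Nat.exists_eq_succ_of_ne_zero (by simpa using hn)
      exact hminus m
  refine ⟨fourierCoeff H 0, ?_⟩
  set C := fourierCoeff H 0
  have hzero : (H + fun t => -C * fourier 0 t) =ᵐ[haarAddCircle] 0 := by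
    have hi : Integrable (fun t : AddCircle T => -C * fourier 0 t) haarAddCircle := by
      simp
    refine ae_eq_zero_of_fourierCoeff_eq_zero (hgf_int.add hi) fun n => ?_
    rw [fourierCoeff.add hgf_int hi, Pi.add_apply, fourierCoeff.const_mul, fourierCoeff_fourier]
    by_cases hn : n = 0
    · subst hn
      simp [C]
    · simp [hne n hn, hn]
  filter_upwards [hzero] with t ht
  simpa [add_neg_eq_zero] using ht

end Hardy

/-- If `φ ∈ L²(𝕋)` is real valued, `[T_φ]_max = [T_φ]_min` (finitely supported sequences are
dense in `Dom T_φ` for the graph norm), and `T_φ` has a nontrivial kernel, then `φ = 0` a.e. -/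
theorem stmt_13 (φ : Lp ℂ 2 (haarAddCircle (T := 2 * Real.pi)))
    (hreal : ∀ᵐ x ∂(haarAddCircle (T := 2 * Real.pi)), ((⇑φ) x).im = 0)
    (hdense : ∀ (f : ellTwo) (hf : Memℓp (toeplitz (fourierCoeff ⇑φ) (⇑f)) 2)
      (ε : ℝ), 0 < ε →
      ∃ (p : ellTwo) (_ : FinSupp (⇑p)) (hp : Memℓp (toeplitz (fourierCoeff ⇑φ) (⇑p)) 2),
        ‖f - p‖ ^ 2 +
          ‖(⟨toeplitz (fourierCoeff ⇑φ) (⇑f), hf⟩ : ellTwo) -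
            (⟨toeplitz (fourierCoeff ⇑φ) (⇑p), hp⟩ : ellTwo)‖ ^ 2 < ε ^ 2)
    (hker : ∃ f : ellTwo, f ≠ 0 ∧ Memℓp (toeplitz (fourierCoeff ⇑φ) (⇑f)) 2 ∧
      toeplitz (fourierCoeff ⇑φ) (⇑f) = 0) :
    ∀ᵐ x ∂(haarAddCircle (T := 2 * Real.pi)), (⇑φ) x = 0 := by
  obtain ⟨f, hf0, -, hTf⟩ := hker
  set b := fourierCoeff ⇑φ with hbdef
  have hb : Memℓp b 2 := memℓp_fourierCoeff_s13 (Lp.memLp φ)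
  have hsymm : ∀ n, b (-n) = conj (b n) := by
    intro n
    have hφ : (fun t => conj (φ t)) =ᵐ[haarAddCircle] φ := by
      filter_upwards [hreal] with t ht using Complex.conj_eq_iff_im.2 ht
    have h := fourierCoeff_conj (⇑φ) (-n)
    rwa [fourierCoeff_congr_ae hφ, neg_neg] at h
  obtain ⟨h, hh, h0⟩ := exists_mem_toeplitzKer_apply_zero_ne_zero (hb := hb)
    (mem_toeplitzKer.2 fun j => congrFun hTf j) hf0
  have hiter : ∀ (m : ℕ) {u : ellTwo}, u ∈ toeplitzKer b hb → shift^[m] u ∈ toeplitzKer b hb := by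
    intro m u hu
    induction m with
    | zero => exact hu
    | succ m ih =>
      rw [Function.iterate_succ_apply']
      exact shift_mem_toeplitzKer hsymm hdense ih hh h0
  have : CompleteSpace (toeplitzKer b hb) :=
    (Submodule.isClosed_orthogonal _).completeSpace_coe
  set g : ellTwo := (toeplitzKer b hb).starProjection (lp.single 2 0 1)
  have hgK : g ∈ toeplitzKer b hb := Submodule.starProjection_apply_mem _ _
  have hgrep : ∀ u ∈ toeplitzKer b hb, inner ℂ g u = u 0 := by
    intro u hu
    rw [Submodule.inner_starProjection_left_eq_right, Submodule.starProjection_eq_self_iff.2 hu,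
      lp.inner_single_left]
    simp
  have hgne : g ≠ 0 := fun hg => h0 (by rw [← hgrep h hh, hg, inner_zero_left])
  obtain ⟨G, hG, hGg, hGneg⟩ := exists_hardy_fourierCoeff (T := 2 * Real.pi) g
  obtain ⟨C, hC⟩ := ae_conj_mul_self_eq_of_inner_iterate_shift hG hGg hGneg fun m => by
    rw [hgrep _ (hiter _ hgK), Function.iterate_succ_apply', shift_zero]
  have hprod : (fun t => φ t * G t) =ᵐ[haarAddCircle] 0 := by
    refine ae_eq_zero_of_fourierCoeff_eq_zero ((Lp.memLp φ).integrable_mul hG) fun n => ?_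
    rw [fourierCoeff_mul_eq_intToeplitz (Lp.memLp φ) hG hGg hGneg]
    obtain ⟨m, rfl | rfl⟩ := Int.eq_nat_or_neg n
    · exact mem_toeplitzKer.1 hgK m
    · rw [← zero_sub, ← intToeplitz_iterate_shift hb]
      exact mem_toeplitzKer.1 (hiter m hgK) 0
  have hC0 : C ≠ 0 := by
    rintro rfl
    have hG0 : G =ᵐ[haarAddCircle] 0 := by
      filter_upwards [hC] with t ht
      simpa using ht
    refine hgne ?_
    ext k
    rw [← hGg k, fourierCoeff_congr_ae hG0]
    simp [fourierCoeff]
  filter_upwards [hprod, hC] with t ht htC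
  refine (mul_eq_zero.1 ht).resolve_right fun hGt => hC0 ?_
  rw [← htC, hGt, mul_zero]
end
end
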